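/- Let f_1, …, f_z be the LZ-End parsing of a string S with z ≥ 2, let α be a single character, and let g_1, …, g_{z'} be the LZ-End parsing of Sα. Then z − 1 ≤ z' ≤ z + 1, and the first z − 2 phrases coincide: g_j = f_j for all 1 ≤ j ≤ z − 2. -/

import Mathlib

/-- `IsLZEnd S fs` states that `fs = [f₁, …, f_z]` is the (greedy) LZ-End parsing of `S`:
the phrases concatenate to `S`; each phrase is nonempty; for each phrase `f_i`
(0-based index `k`, so `i = k+1`) starting at position `b = |f₁⋯f_k|`, the phrase without its
last character is a suffix of `f₁⋯f_p` for some `p < i` (i.e. `p ≤ k` with `f₁⋯f₀ = ε`);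
and its copyable part has maximal length: any `ℓ` with `b + ℓ + 1 ≤ |S|` such that
`S[b..b+ℓ-1]` is a suffix of some `f₁⋯f_p` with `p ≤ k` satisfies `ℓ ≤ |f_i| - 1`. -/
def IsLZEnd {α : Type*} (S : List α) (fs : List (List α)) : Prop :=
  fs.flatten = S ∧
  ∀ k, (hk : k < fs.length) →
    1 ≤ fs[k].length ∧
    (∃ p ≤ k, fs[k].dropLast <:+ (fs.take p).flatten) ∧
    (∀ ℓ, ((fs.take k).flatten).length + ℓ + 1 ≤ S.length →
      (∃ p ≤ k, (S.drop ((fs.take k).flatten).length).take ℓ <:+ (fs.take p).flatten) →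
      ℓ + 1 ≤ fs[k].length)

theorem List.flatten_drop_eq_getElem_append {α : Type*} {L : List (List α)} {k : ℕ}
    (hk : k < L.length) : (L.drop k).flatten = L[k] ++ (L.drop (k + 1)).flatten := by
  rw [List.drop_eq_getElem_cons hk, List.flatten_cons]

theorem List.IsSuffix.dropLast_of_ne_nil {α : Type*} {l₁ l₂ : List α} (h : l₁ <:+ l₂)
    (hne : l₁ ≠ []) : l₁.dropLast <:+ l₂.dropLast := by
  obtain ⟨t, rfl⟩ := h
  rw [List.dropLast_append_of_ne_nil hne]
  exact List.suffix_append _ _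

namespace IsLZEnd

variable {α : Type*} {S : List α} {fs gs : List (List α)}

/-- Dropping the first `k` phrases from the string leaves the remaining phrases. -/
theorem drop_eq (h : IsLZEnd S fs) (k : ℕ) :
    S.drop (fs.take k).flatten.length = (fs.drop k).flatten := by
  have h1 : S = (fs.take k).flatten ++ (fs.drop k).flatten := by
    rw [← List.flatten_append, List.take_append_drop, h.1]
  conv_lhs => rw [h1]
  simp

theorem length_eq (h : IsLZEnd S fs) (k : ℕ) :
    S.length = (fs.take k).flatten.length + (fs.drop k).flatten.length := by
  rw [← List.length_append, ← List.flatten_append, List.take_append_drop, h.1]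

theorem length_le_of_flatten_drop_eq_nil (h : IsLZEnd S fs) {k : ℕ}
    (hk : (fs.drop k).flatten = []) : fs.length ≤ k := by
  by_contra! hlt
  rw [List.drop_eq_getElem_cons hlt, List.flatten_cons, List.append_eq_nil_iff] at hk
  have := (h.2 k hlt).1
  simp [hk.1] at this

/-- A phrase is at least as long as any copyable prefix of the remaining string, plus one. -/
theorem lt_length (h : IsLZEnd S fs) {k : ℕ} (hk : k < fs.length) {l : ℕ}
    (hl : l < (fs.drop k).flatten.length) {p : ℕ} (hp : p ≤ k)
    (hs : (fs.drop k).flatten.take l <:+ (fs.take p).flatten) : l < fs[k].length := by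
  refine (h.2 k hk).2.2 l ?_ ⟨p, hp, ?_⟩
  · rw [h.length_eq k]; omega
  · rwa [h.drop_eq]

/-- If everything from the `k`-th phrase on is a suffix of an earlier concatenation of phrases,
then at most two phrases remain. -/
theorem length_le_of_flatten_drop_suffix (h : IsLZEnd S fs) {k p : ℕ} (hk : k < fs.length)
    (hp : p ≤ k) (hs : (fs.drop k).flatten <:+ (fs.take p).flatten) : fs.length ≤ k + 2 := by
  by_cases hk1 : fs.length ≤ k + 1
  · omega
  replace hk1 : k + 1 < fs.length := by omega
  have hR := List.flatten_drop_eq_getElem_append hk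
  have hT : _ = _ ++ (fs.drop (k + 2)).flatten := List.flatten_drop_eq_getElem_append hk1
  have hpos := (h.2 k hk).1
  have hpos1 := (h.2 (k + 1) hk1).1
  have hTR : (fs.drop (k + 1)).flatten <:+ (fs.drop k).flatten := by
    rw [hR]; exact List.suffix_append _ _
  obtain _ | q := p
  · rw [List.take_zero, List.flatten_nil, List.suffix_nil, hR, List.append_eq_nil_iff] at hs
    simp [hs.1] at hpos
  have hq : q < fs.length := by omega
  have hB : (fs.take (q + 1)).flatten = (fs.take q).flatten ++ fs[q] := by
    rw [List.take_succ_eq_append_getElem hq, List.flatten_append, List.flatten_singleton]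
  have hfq : fs[q] <:+ (fs.take (q + 1)).flatten := hB ▸ List.suffix_append _ _
  have hTq : (fs.drop (k + 1)).flatten <:+ fs[q] := by
    rcases List.suffix_or_suffix_of_suffix hs hfq with hc | hc
    · exact hTR.trans hc
    · refine List.suffix_of_suffix_length_le hTR hc ?_
      obtain ⟨Y, hY⟩ := hc
      have hYs : Y <:+ (fs.take q).flatten := by
        rwa [← hY, hB, List.suffix_append_self_iff] at hs
      have hlen := congrArg List.length hY
      have hlen' := congrArg List.length hR
      rw [List.length_append] at hlen hlen'
      have hposq := (h.2 q hq).1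
      have := h.lt_length hk (l := Y.length) (by omega) (p := q) (by omega)
        (by rwa [← hY, List.take_left])
      omega
  have hTne : (fs.drop (k + 1)).flatten ≠ [] := by
    rw [hT]; intro h0
    rw [List.append_eq_nil_iff] at h0
    simp [h0.1] at hpos1
  obtain ⟨r, hr, hrs⟩ := (h.2 q hq).2.1
  have hlt := h.lt_length hk1 (l := (fs.drop (k + 1)).flatten.length - 1)
    (by have := List.length_pos_iff.2 hTne; omega) (p := r) (by omega)
    (by rw [← List.dropLast_eq_take]; exact (hTq.dropLast_of_ne_nil hTne).trans hrs)
  refine h.length_le_of_flatten_drop_eq_nil (List.length_eq_zero_iff.1 ?_)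
  have hlen := congrArg List.length hT
  rw [List.length_append] at hlen
  omega

/-- While the parsings of `S` and `S ++ [a]` agree, either they agree on one more phrase, or the
next phrase of the latter is its last one. -/
theorem take_succ_eq_or (hf : IsLZEnd S fs) {a : α} (hg : IsLZEnd (S ++ [a]) gs) {k : ℕ}
    (hk : k < fs.length) (ht : gs.take k = fs.take k) :
    gs.take (k + 1) = fs.take (k + 1) ∨ gs.length = k + 1 ∧ fs.length ≤ k + 2 := by
  have hD : (gs.drop k).flatten = (fs.drop k).flatten ++ [a] := by
    rw [← hg.drop_eq, ht, ← hf.drop_eq, List.drop_append_of_le_length]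
    rw [hf.length_eq k]; omega
  have hkg : k < gs.length := by
    by_contra! hle
    simp [List.drop_eq_nil_of_le hle] at hD
  have hRf := List.flatten_drop_eq_getElem_append hk
  have hRg := List.flatten_drop_eq_getElem_append hkg
  have hposf := (hf.2 k hk).1
  have hposg := (hg.2 k hkg).1
  have htp : ∀ p ≤ k, gs.take p = fs.take p := fun p hp => by
    have := congrArg (List.take p) ht
    rwa [List.take_take, List.take_take, min_eq_left hp] at this
  have hef : fs[k] = (fs.drop k).flatten.take fs[k].length := by rw [hRf, List.take_left]
  have heg : gs[k] = ((fs.drop k).flatten ++ [a]).take gs[k].length := by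
    rw [← hD, hRg, List.take_left]
  have hlf := congrArg List.length hRf
  have hlg := congrArg List.length hRg
  have hlD := congrArg List.length hD
  simp only [List.length_append, List.length_singleton] at hlf hlg hlD
  obtain ⟨p, hp, hps⟩ := (hf.2 k hk).2.1
  obtain ⟨q, hq, hqs⟩ := (hg.2 k hkg).2.1
  rw [htp q hq] at hqs
  rcases Nat.lt_or_ge (fs.drop k).flatten.length gs[k].length with hn | hn
  · right
    have hnil : (gs.drop (k + 1)).flatten = [] := List.length_eq_zero_iff.1 (by omega)
    have hle := hg.length_le_of_flatten_drop_eq_nil hnil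
    refine ⟨by omega, hf.length_le_of_flatten_drop_suffix hk hq ?_⟩
    rwa [← List.append_nil gs[k], ← hnil, ← hRg, hD, List.dropLast_concat] at hqs
  · left
    rw [List.take_append_of_le_length hn] at heg
    have h1 : gs[k].length - 1 < fs[k].length := by
      refine hf.lt_length hk (by omega) hq ?_
      rwa [List.dropLast_eq_take, heg, List.take_take, ← heg, min_eq_left (by omega)] at hqs
    have h2 : fs[k].length - 1 < gs[k].length := by
      refine hg.lt_length hkg (by omega) hp ?_
      rw [htp p hp, hD, List.take_append_of_le_length (by omega)]
      rwa [List.dropLast_eq_take, hef, List.take_take, ← hef, min_eq_left (by omega)] at hps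
    have hlen : gs[k].length = fs[k].length := by omega
    rw [List.take_succ_eq_append_getElem hk, List.take_succ_eq_append_getElem hkg, ht, heg, hlen,
      ← hef]

theorem take_eq_or (hf : IsLZEnd S fs) {a : α} (hg : IsLZEnd (S ++ [a]) gs) {k : ℕ}
    (hk : k ≤ fs.length) :
    gs.take k = fs.take k ∨
      ∃ j < k, gs.take j = fs.take j ∧ gs.length = j + 1 ∧ fs.length ≤ j + 2 := by
  induction k with
  | zero => simp
  | succ k ih =>
    rcases ih (by omega) with h | ⟨j, hj, h⟩
    · rcases hf.take_succ_eq_or hg hk h with h' | h'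
      · exact Or.inl h'
      · exact Or.inr ⟨k, by omega, h, h'⟩
    · exact Or.inr ⟨j, by omega, h⟩

end IsLZEnd

/-- If `f₁, …, f_z` (`z ≥ 2`) is the LZ-End parsing of `S` and `g₁, …, g_{z'}` is the
LZ-End parsing of `Sα`, then `z - 1 ≤ z' ≤ z + 1` and the first `z - 2` phrases
coincide. -/
theorem lzEnd_stability {α : Type*} (S : List α) (a : α)
    (fs gs : List (List α)) (hz : 2 ≤ fs.length)
    (hfs : IsLZEnd S fs) (hgs : IsLZEnd (S ++ [a]) gs) :
    fs.length - 1 ≤ gs.length ∧ gs.length ≤ fs.length + 1 ∧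
    gs.take (fs.length - 2) = fs.take (fs.length - 2) := by
  rcases hfs.take_eq_or hgs le_rfl with h | ⟨j, hj, ht, hlen, hle⟩
  · have hD : (gs.drop fs.length).flatten = [a] := by
      rw [← hgs.drop_eq, h, List.take_length, hfs.1, List.drop_left]
    have hlt : fs.length < gs.length := by
      by_contra! hle
      simp [List.drop_eq_nil_of_le hle] at hD
    have hle : gs.length ≤ fs.length + 1 := by
      apply hgs.length_le_of_flatten_drop_eq_nil
      apply List.length_eq_zero_iff.1
      have hpos := (hgs.2 _ hlt).1
      have hl := congrArg List.length hD
      rw [List.flatten_drop_eq_getElem_append hlt, List.length_append,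
        List.length_singleton] at hl
      omega
    refine ⟨by omega, hle, ?_⟩
    have := congrArg (List.take (fs.length - 2)) h
    rwa [List.take_take, List.take_take, min_eq_left (by omega)] at this
  · refine ⟨by omega, by omega, ?_⟩
    have := congrArg (List.take (fs.length - 2)) ht
    rwa [List.take_take, List.take_take, min_eq_left (by omega)] at this
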